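/- Let Φ be a norm on ℝ^{n+1} cylindrical over a norm φ on ℝ^n, Ω̂ ⊆ ℝ^n an open set, u ∈ M_{Φ^o}(Ω̂), and λ ∈ ℝ. Then the characteristic functions χ_{{u > λ}} and χ_{{u ≥ λ}} belong to M_{Φ^o}(Ω̂). -/

import Mathlib

open MeasureTheory Set Filter

noncomputable section

/-- `ℝ^n` with the Euclidean norm. -/
abbrev Rn (n : ℕ) := EuclideanSpace ℝ (Fin n)

/-- `ℝ^{n+1} = ℝ^n × ℝ`. -/
abbrev Rn1 (n : ℕ) := Rn n × ℝ

/-- Euclidean dot product on `ℝ^n`. -/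
def dotn {n : ℕ} (x y : Rn n) : ℝ := ∑ i, x i * y i

/-- Euclidean dot product on `ℝ^{n+1} = ℝ^n × ℝ`. -/
def dotp {n : ℕ} (x y : Rn1 n) : ℝ := dotn x.1 y.1 + x.2 * y.2

/-- Euclidean norm on `ℝ^{n+1} = ℝ^n × ℝ`. -/
def enorm1 {n : ℕ} (x : Rn1 n) : ℝ := Real.sqrt (dotp x x)

/-- `Ψ` is a norm on `ℝ^n`: convex, absolutely one-homogeneous and bounded
below by a positive multiple of the Euclidean norm. -/
def IsNormN {n : ℕ} (Ψ : Rn n → ℝ) : Prop :=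
  ConvexOn ℝ univ Ψ ∧ (∀ (c : ℝ) (ξ : Rn n), Ψ (c • ξ) = |c| * Ψ ξ) ∧
    ∃ c > (0:ℝ), ∀ ξ, c * ‖ξ‖ ≤ Ψ ξ

/-- `Φ` is a norm on `ℝ^{n+1}`. -/
def IsNorm1 {n : ℕ} (Φ : Rn1 n → ℝ) : Prop :=
  ConvexOn ℝ univ Φ ∧ (∀ (c : ℝ) (ξ : Rn1 n), Φ (c • ξ) = |c| * Φ ξ) ∧
    ∃ c > (0:ℝ), ∀ ξ, c * enorm1 ξ ≤ Φ ξ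

/-- Dual norm on `ℝ^n`: `Ψ^o(ξ*) = sup {ξ*·ξ : Ψ(ξ) ≤ 1}`. -/
def dualN {n : ℕ} (Ψ : Rn n → ℝ) (xs : Rn n) : ℝ :=
  sSup ((fun ξ => dotn xs ξ) '' {ξ | Ψ ξ ≤ 1})

/-- Dual norm on `ℝ^{n+1}`. -/
def dual1 {n : ℕ} (Φ : Rn1 n → ℝ) (xs : Rn1 n) : ℝ :=
  sSup ((fun ξ => dotp xs ξ) '' {ξ | Φ ξ ≤ 1})

/-- `Φ` is cylindrical over `φ`: `Φ(ξ̂,ξ_{n+1}) = max (φ(ξ̂), |ξ_{n+1}|)`. -/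
def Cylindrical {n : ℕ} (Φ : Rn1 n → ℝ) (φ : Rn n → ℝ) : Prop :=
  ∀ ξ : Rn1 n, Φ ξ = max (φ ξ.1) |ξ.2|

/-- `A` is an open set compactly contained in `O`. -/
def CpCtd {E : Type*} [TopologicalSpace E] (A O : Set E) : Prop :=
  IsOpen A ∧ IsCompact (closure A) ∧ closure A ⊆ O

/-- Divergence of a vector field on `ℝ^n`. -/
def divN {n : ℕ} (η : Rn n → Rn n) (x : Rn n) : ℝ :=
  ∑ i, fderiv ℝ η x (EuclideanSpace.single i (1:ℝ)) i

/-- Divergence of a vector field on `ℝ^{n+1} = ℝ^n × ℝ`. -/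
def div1 {n : ℕ} (η : Rn1 n → Rn1 n) (z : Rn1 n) : ℝ :=
  (∑ i, (fderiv ℝ η z (EuclideanSpace.single i (1:ℝ), (0:ℝ))).1 i) +
    (fderiv ℝ η z ((0 : Rn n), (1:ℝ))).2

/-- Admissible test vector fields on `ℝ^n`: `C^1`, compactly supported in `A`,
with values in the unit ball of `Ψ`. -/
def TestN {n : ℕ} (A : Set (Rn n)) (Ψ : Rn n → ℝ) (η : Rn n → Rn n) : Prop :=
  ContDiff ℝ 1 η ∧ HasCompactSupport η ∧ tsupport η ⊆ A ∧ ∀ x, Ψ (η x) ≤ 1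

/-- Admissible test vector fields on `ℝ^{n+1}`. -/
def Test1 {n : ℕ} (A : Set (Rn1 n)) (Φ : Rn1 n → ℝ) (η : Rn1 n → Rn1 n) : Prop :=
  ContDiff ℝ 1 η ∧ HasCompactSupport η ∧ tsupport η ⊆ A ∧ ∀ z, Φ (η z) ≤ 1

/-- The set of numbers whose supremum is the anisotropic perimeter `P_Ψ(E,A)` in `ℝ^n`. -/
def perSetN {n : ℕ} (Ψ : Rn n → ℝ) (E A : Set (Rn n)) : Set ℝ :=
  {r | ∃ η, TestN A Ψ η ∧ r = -∫ x in E, divN η x}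

/-- Anisotropic perimeter `P_Ψ(E,A)` in `ℝ^n`. -/
def PerN {n : ℕ} (Ψ : Rn n → ℝ) (E A : Set (Rn n)) : ℝ := sSup (perSetN Ψ E A)

/-- `E` has locally finite perimeter in `O ⊆ ℝ^n`. -/
def BVlocSetN {n : ℕ} (O E : Set (Rn n)) : Prop :=
  ∀ A, CpCtd A O → BddAbove (perSetN (fun x => ‖x‖) E A)

/-- `E` is a minimizer of `P_Ψ` (by compact perturbations) in `O ⊆ ℝ^n`. -/
def MinPerN {n : ℕ} (Ψ : Rn n → ℝ) (O E : Set (Rn n)) : Prop :=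
  BVlocSetN O E ∧ ∀ A, CpCtd A O → ∀ F, BVlocSetN O F →
    IsCompact (closure (symmDiff E F)) → closure (symmDiff E F) ⊆ A →
      PerN Ψ E A ≤ PerN Ψ F A

/-- The set of numbers whose supremum is the anisotropic perimeter `P_Φ(E,A)` in `ℝ^{n+1}`. -/
def perSet1 {n : ℕ} (Φ : Rn1 n → ℝ) (E A : Set (Rn1 n)) : Set ℝ :=
  {r | ∃ η, Test1 A Φ η ∧ r = -∫ z in E, div1 η z}

/-- Anisotropic perimeter `P_Φ(E,A)` in `ℝ^{n+1}`. -/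
def Per1 {n : ℕ} (Φ : Rn1 n → ℝ) (E A : Set (Rn1 n)) : ℝ := sSup (perSet1 Φ E A)

/-- `E` has locally finite perimeter in `O ⊆ ℝ^{n+1}`. -/
def BVlocSet1 {n : ℕ} (O E : Set (Rn1 n)) : Prop :=
  ∀ A, CpCtd A O → BddAbove (perSet1 enorm1 E A)

/-- `E` is a minimizer of `P_Φ` (by compact perturbations) in `O ⊆ ℝ^{n+1}`. -/
def MinPer1 {n : ℕ} (Φ : Rn1 n → ℝ) (O E : Set (Rn1 n)) : Prop :=
  BVlocSet1 O E ∧ ∀ A, CpCtd A O → ∀ F, BVlocSet1 O F →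
    IsCompact (closure (symmDiff E F)) → closure (symmDiff E F) ⊆ A →
      Per1 Φ E A ≤ Per1 Φ F A

/-- The set of numbers whose supremum is the total variation `TV(u,A)`. -/
def varSet {n : ℕ} (A : Set (Rn n)) (u : Rn n → ℝ) : Set ℝ :=
  {r | ∃ η, TestN A (fun x => ‖x‖) η ∧ r = ∫ x in A, u x * divN η x}

/-- Total variation `TV(u,A)`. -/
def TV {n : ℕ} (u : Rn n → ℝ) (A : Set (Rn n)) : ℝ := sSup (varSet A u)

/-- `u ∈ BV_loc(Ω̂)`. -/
def BVlocFun {n : ℕ} (Ω : Set (Rn n)) (u : Rn n → ℝ) : Prop :=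
  (∀ A, CpCtd A Ω → IntegrableOn u A) ∧ ∀ A, CpCtd A Ω → BddAbove (varSet A u)

/-- The set of numbers whose supremum is `G_{Φ^o}(u,A)`. -/
def Gset {n : ℕ} (Φ : Rn1 n → ℝ) (A : Set (Rn n)) (u : Rn n → ℝ) : Set ℝ :=
  {r | ∃ η : Rn n → Rn1 n, ContDiff ℝ 1 η ∧ HasCompactSupport η ∧ tsupport η ⊆ A ∧
    (∀ x, Φ (η x) ≤ 1) ∧ r = ∫ x in A, (u x * divN (fun y => (η y).1) x + (η x).2)}

/-- The functional `G_{Φ^o}(u,A)`. -/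
def Gfun {n : ℕ} (Φ : Rn1 n → ℝ) (u : Rn n → ℝ) (A : Set (Rn n)) : ℝ := sSup (Gset Φ A u)

/-- `w` has compact support contained in `A`. -/
def CptSupp {n : ℕ} (A : Set (Rn n)) (w : Rn n → ℝ) : Prop :=
  IsCompact (tsupport w) ∧ tsupport w ⊆ A

/-- `u` is a minimizer of `G_{Φ^o}` by compact perturbations in `Ω̂`,
i.e. `u ∈ M_{Φ^o}(Ω̂)`. -/
def MinG {n : ℕ} (Φ : Rn1 n → ℝ) (Ω : Set (Rn n)) (u : Rn n → ℝ) : Prop :=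
  BVlocFun Ω u ∧ ∀ A, CpCtd A Ω → ∀ v, BVlocFun Ω v →
    CptSupp A (fun x => u x - v x) → Gfun Φ u A ≤ Gfun Φ v A

/-- `u` is a minimizer of the total variation by compact perturbations in `Ω̂`. -/
def MinTV {n : ℕ} (Ω : Set (Rn n)) (u : Rn n → ℝ) : Prop :=
  BVlocFun Ω u ∧ ∀ A, CpCtd A Ω → ∀ v, BVlocFun Ω v →
    CptSupp A (fun x => u x - v x) → TV u A ≤ TV v A

/-- Subgraph of `u : Ω̂ → ℝ`. -/
def sg {n : ℕ} (Ω : Set (Rn n)) (u : Rn n → ℝ) : Set (Rn1 n) :=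
  {p | p.1 ∈ Ω ∧ p.2 < u p.1}

/-- `S` is locally a Lipschitz graph at `p`. -/
def IsLocLipGraphAt {n : ℕ} (S : Set (Rn1 n)) (p : Rn1 n) : Prop :=
  ∃ U : Set (Rn1 n), IsOpen U ∧ p ∈ U ∧ ∃ e : Rn1 n, enorm1 e = 1 ∧
    ∃ g : Rn1 n → ℝ, (∃ L : NNReal, LipschitzOnWith L g {y | dotp y e = 0}) ∧
      S ∩ U = {z | ∃ y, dotp y e = 0 ∧ z = y + g y • e} ∩ U

/-- `Φ` is a partially monotone norm on `ℝ^{n+1}`. -/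
def PartMono {n : ℕ} (Φ : Rn1 n → ℝ) : Prop :=
  ∀ ξ η : Rn1 n, Φ (ξ.1, 0) ≤ Φ (η.1, 0) → Φ ((0 : Rn n), ξ.2) ≤ Φ ((0 : Rn n), η.2) →
    Φ ξ ≤ Φ η

end

open MeasureTheory Set Filter Topology


theorem divN_cont {n : ℕ} {η : Rn n → Rn n} (h : ContDiff ℝ 1 η) : Continuous (divN η) := by
  unfold divN
  have h1 : Continuous (fderiv ℝ η) := h.continuous_fderiv one_ne_zero
  refine continuous_finsetSum _ fun i _ => ?_
  have : Continuous fun x => fderiv ℝ η x (EuclideanSpace.single i (1:ℝ)) := h1.clm_apply continuous_const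
  fun_prop

theorem divN_zero_of_notMem {n : ℕ} {η : Rn n → Rn n} {x : Rn n} (hx : x ∉ tsupport η) :
    divN η x = 0 := by
  have : fderiv ℝ η x = 0 := by
    have := support_fderiv_subset ℝ (f := η)
    by_contra h
    exact hx (this h)
  simp [divN, this]

theorem divN_cs {n : ℕ} {η : Rn n → Rn n} (h : HasCompactSupport η) : HasCompactSupport (divN η) :=
  HasCompactSupport.intro h fun _ hx => divN_zero_of_notMem hx

theorem divN_add {n : ℕ} {η ζ : Rn n → Rn n} (h : ContDiff ℝ 1 η) (h' : ContDiff ℝ 1 ζ) (x : Rn n) :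
    divN (fun y => η y + ζ y) x = divN η x + divN ζ x := by
  have h1 := (h.differentiable one_ne_zero) x
  have h2 := (h'.differentiable one_ne_zero) x
  simp [divN, fderiv_fun_add h1 h2, Finset.sum_add_distrib]

theorem fderiv_sum_single {n : ℕ} (L : Rn n →L[ℝ] ℝ) (v : Rn n) :
    ∑ i, L (EuclideanSpace.single i (1:ℝ)) * v i = L v := by
  have : v = ∑ i, v i • EuclideanSpace.single i (1:ℝ) := by
    have := (EuclideanSpace.basisFun (Fin n) ℝ).sum_repr v
    simpa using this.symm
  conv_rhs => rw [this]
  simp [map_sum, mul_comm]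

theorem divN_smul {n : ℕ} {ψ : Rn n → ℝ} {η : Rn n → Rn n} (h : ContDiff ℝ 1 ψ)
    (h' : ContDiff ℝ 1 η) (x : Rn n) :
    divN (fun y => ψ y • η y) x = ψ x * divN η x + fderiv ℝ ψ x (η x) := by
  have h1 := (h.differentiable one_ne_zero) x
  have h2 := (h'.differentiable one_ne_zero) x
  rw [← fderiv_sum_single]
  simp [divN, fderiv_fun_smul h1 h2, Finset.sum_add_distrib, Finset.mul_sum]

theorem divN_const_smul {n : ℕ} (c : ℝ) {η : Rn n → Rn n} (h' : ContDiff ℝ 1 η) (x : Rn n) :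
    divN (fun y => c • η y) x = c * divN η x := by
  rw [divN_smul contDiff_const h']; simp

theorem divN_shift {n : ℕ} (t : Rn n) (η : Rn n → Rn n) (x : Rn n) :
    divN (fun y => η (y + t)) x = divN η (x + t) := by
  simp [divN, fderiv_comp_add_right]

theorem divN_bdd {n : ℕ} {η : Rn n → Rn n} (h : ContDiff ℝ 1 η) (h' : HasCompactSupport η) :
    ∃ C, ∀ x, ‖divN η x‖ ≤ C :=
  (divN_cs h').exists_bound_of_continuous (divN_cont h)

theorem int_divN {n : ℕ} {u : Rn n → ℝ} {μ : Measure (Rn n)} (hu : Integrable u μ)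
    {η : Rn n → Rn n} (h : ContDiff ℝ 1 η) (h' : HasCompactSupport η) :
    Integrable (fun x => u x * divN η x) μ := by
  obtain ⟨C, hC⟩ := divN_bdd h h'
  exact hu.mul_bdd (c := C) (divN_cont h).aestronglyMeasurable (.of_forall hC)

theorem integral_divN_zero {n : ℕ} {η : Rn n → Rn n} (h : ContDiff ℝ 1 η)
    (h' : HasCompactSupport η) : ∫ x, divN η x = 0 := by
  have hc : Continuous (fderiv ℝ η) := h.continuous_fderiv one_ne_zero
  have key : ∀ i : Fin n, Integrable (fun x => fderiv ℝ η x (EuclideanSpace.single i (1:ℝ)) i) ∧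
      ∫ x, fderiv ℝ η x (EuclideanSpace.single i (1:ℝ)) i = 0 := by
    intro i
    have e : ∀ x, fderiv ℝ η x (EuclideanSpace.single i (1:ℝ)) i
        = fderiv ℝ (fun y => η y i) x (EuclideanSpace.single i (1:ℝ)) := by
      intro x
      have h2 := ((h.differentiable one_ne_zero) x).hasFDerivAt
      have h3 := ((EuclideanSpace.proj i : Rn n →L[ℝ] ℝ).hasFDerivAt (x := η x)).comp x h2
      have h4 : fderiv ℝ (fun y => η y i) x = _ := h3.fderiv
      rw [h4]; rfl
    have c1 : Continuous fun x => fderiv ℝ η x (EuclideanSpace.single i (1:ℝ)) i := by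
      have : Continuous fun x => fderiv ℝ η x (EuclideanSpace.single i (1:ℝ)) := hc.clm_apply continuous_const
      fun_prop
    have s1 : HasCompactSupport fun x => fderiv ℝ η x (EuclideanSpace.single i (1:ℝ)) i := by
      refine HasCompactSupport.intro h' fun x hx => ?_
      have : fderiv ℝ η x = 0 := by
        by_contra hh
        exact hx (support_fderiv_subset ℝ (f := η) hh)
      simp [this]
    have I1 := c1.integrable_of_hasCompactSupport (μ := volume) s1
    refine ⟨I1, ?_⟩
    have c0 : Continuous fun x => η x i := by
      have := h.continuous
      fun_prop
    have s0 : HasCompactSupport fun x => η x i :=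
      HasCompactSupport.intro h' fun x hx => by simp [image_eq_zero_of_notMem_tsupport hx]
    have I0 := c0.integrable_of_hasCompactSupport (μ := volume) s0
    have := integral_mul_fderiv_eq_neg_fderiv_mul_of_integrable (𝕜 := ℝ) (μ := (volume : Measure (Rn n)))
      (f := fun _ => (1:ℝ)) (g := fun y => η y i) (v := EuclideanSpace.single i (1:ℝ))
      (by simp) (by simpa [← e] using I1) (by simpa using I0) (by simp)
      (by
        intro x _
        have hd : ContDiff ℝ 1 fun y => η y i := by fun_prop
        exact hd.differentiable one_ne_zero x)
    simpa [← e] using this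
  unfold divN
  rw [integral_finsetSum _ fun i _ => (key i).1]
  exact Finset.sum_eq_zero fun i _ => (key i).2

theorem chain_divN {n : ℕ} {f : Rn n → ℝ} {η : Rn n → Rn n} {H g : ℝ → ℝ}
    (hf : ContDiff ℝ 1 f) (hη : ContDiff ℝ 1 η) (hη' : HasCompactSupport η)
    (hg : ContDiff ℝ 1 g) (hH : ∀ t, HasDerivAt H (g t) t) :
    ∫ x, f x * divN (fun y => g (f y) • η y) x = ∫ x, H (f x) * divN η x := by
  have hH1 : ContDiff ℝ 1 H := by
    rw [contDiff_one_iff_deriv]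
    refine ⟨fun t => (hH t).differentiableAt, ?_⟩
    have : deriv H = g := funext fun t => (hH t).deriv
    rw [this]; exact hg.continuous
  have hgf : ContDiff ℝ 1 fun y => g (f y) := hg.comp hf
  have hHf : ContDiff ℝ 1 fun y => H (f y) := hH1.comp hf
  have hq : ContDiff ℝ 1 fun y => f y * g (f y) - H (f y) := (hf.mul hgf).sub hHf
  have hqη : ContDiff ℝ 1 fun y => (f y * g (f y) - H (f y)) • η y := hq.smul hη
  have hgη : ContDiff ℝ 1 fun y => g (f y) • η y := hgf.smul hη
  have cqη : HasCompactSupport fun y => (f y * g (f y) - H (f y)) • η y :=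
    HasCompactSupport.intro hη' fun x hx => by simp [image_eq_zero_of_notMem_tsupport hx]
  have cgη : HasCompactSupport fun y => g (f y) • η y :=
    HasCompactSupport.intro hη' fun x hx => by simp [image_eq_zero_of_notMem_tsupport hx]
  have z := integral_divN_zero hqη cqη
  have i1 : Integrable fun x => f x * divN (fun y => g (f y) • η y) x :=
    (hf.continuous.mul (divN_cont hgη)).integrable_of_hasCompactSupport
      ((divN_cs cgη).mul_left)
  have i2 : Integrable fun x => H (f x) * divN η x :=
    (hHf.continuous.mul (divN_cont hη)).integrable_of_hasCompactSupport
      ((divN_cs hη').mul_left)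
  rw [← sub_eq_zero, ← integral_sub i1 i2, ← z]
  congr 1; ext x
  rw [divN_smul hq hη, divN_smul hgf hη]
  have d1 := ((hf.differentiable one_ne_zero) x)
  have d2 := ((hgf.differentiable one_ne_zero) x)
  have d3 : HasFDerivAt (fun y => H (f y)) (g (f x) • fderiv ℝ f x) x :=
    (hH (f x)).comp_hasFDerivAt x d1.hasFDerivAt
  have d4 := ((d1.hasFDerivAt.mul d2.hasFDerivAt).sub d3).fderiv
  have d5 : fderiv ℝ (fun y => f y * g (f y) - H (f y)) x = _ := d4
  rw [d5]
  simp
  ring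

theorem fub {n : ℕ} {U ρ D : Rn n → ℝ} (hU : Integrable U) (hρ : Continuous ρ)
    (hρ' : HasCompactSupport ρ) (hD : Continuous D) (hD' : HasCompactSupport D) :
    ∫ x, (convolution ρ U (ContinuousLinearMap.lsmul ℝ ℝ) volume) x * D x
      = ∫ t, ρ t * ∫ x, U x * D (x + t) := by
  obtain ⟨C, hC⟩ := hD'.exists_bound_of_continuous hD
  have hi := (hρ.integrable_of_hasCompactSupport (μ := volume) hρ').convolution_integrand
    (ContinuousLinearMap.lsmul ℝ ℝ) hU
  have hi2 : Integrable (fun p : Rn n × Rn n => (ρ p.2 * U (p.1 - p.2)) * D p.1)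
      ((volume : Measure (Rn n)).prod volume) :=
    Integrable.mul_bdd (c := C) (by simpa using hi) (by fun_prop) (.of_forall fun p => hC _)
  calc _ = ∫ x, ∫ t, (ρ t * U (x - t)) * D x := by
        congr 1; ext x
        rw [convolution_def, ← integral_mul_const]; simp
    _ = ∫ t, ∫ x, (ρ t * U (x - t)) * D x := integral_integral_swap hi2
    _ = _ := by
        congr 1; ext t
        rw [← integral_const_mul, ← integral_add_right_eq_self _ t]
        congr 1; ext x
        simp [mul_assoc]

theorem h_cont {n : ℕ} {U D : Rn n → ℝ} (hU : Integrable U) 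
    (hD : Continuous D) (hD' : HasCompactSupport D) :
    Continuous fun t => ∫ x, U x * D (x + t) := by
  obtain ⟨C, hC⟩ := hD'.exists_bound_of_continuous hD
  refine continuous_of_dominated (bound := fun x => ‖U x‖ * C) ?_ ?_ (hU.norm.mul_const _) ?_
  · intro t
    exact hU.aestronglyMeasurable.mul (by fun_prop)
  · intro t
    refine .of_forall fun x => ?_
    rw [norm_mul]
    exact mul_le_mul_of_nonneg_left (hC _) (norm_nonneg _)
  · refine .of_forall fun x => by fun_prop


def Bd {n : ℕ} (φ : Rn n → ℝ) (A : Set (Rn n)) (u : Rn n → ℝ) (M : ℝ) : Prop :=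
  ∀ η, TestN A φ η → ∫ x in A, u x * divN η x ≤ M

theorem conv_le_one {n : ℕ} {φ : Rn n → ℝ} (hc : ConvexOn ℝ univ φ) {a : ℝ} (h0 : 0 ≤ a) (h1 : a ≤ 1)
    {x y : Rn n} (hx : φ x ≤ 1) (hy : φ y ≤ 1) : φ (a • x + (1 - a) • y) ≤ 1 := by
  have := hc.2 (mem_univ x) (mem_univ y) h0 (sub_nonneg.2 h1) (by ring)
  simp only [smul_eq_mul] at this
  nlinarith

theorem TestN.comb {n : ℕ} {φ : Rn n → ℝ} (hc : ConvexOn ℝ univ φ) {A : Set (Rn n)}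
    {η ζ : Rn n → Rn n} (h : TestN A φ η) (h' : TestN A φ ζ) {a : Rn n → ℝ} (ha : ContDiff ℝ 1 a)
    (h0 : ∀ x, 0 ≤ a x) (h1 : ∀ x, a x ≤ 1) :
    TestN A φ (fun x => a x • η x + (1 - a x) • ζ x) ∧
      tsupport (fun x => a x • η x + (1 - a x) • ζ x) ⊆ tsupport η ∪ tsupport ζ := by
  obtain ⟨c1, s1, t1, b1⟩ := h
  obtain ⟨c2, s2, t2, b2⟩ := h'
  have key : tsupport (fun x => a x • η x + (1 - a x) • ζ x) ⊆ tsupport η ∪ tsupport ζ := by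
    refine closure_minimal ?_ ((isClosed_tsupport _).union (isClosed_tsupport _))
    intro x hx
    by_contra hh
    simp only [mem_union, not_or] at hh
    apply hx
    simp [image_eq_zero_of_notMem_tsupport hh.1, image_eq_zero_of_notMem_tsupport hh.2]
  refine ⟨⟨?_, ?_, key.trans (union_subset t1 t2), fun x => conv_le_one hc (h0 x) (h1 x) (b1 x) (b2 x)⟩, key⟩
  · have : ContDiff ℝ 1 fun x => 1 - a x := contDiff_const.sub ha
    exact (ha.smul c1).add (this.smul c2)
  · exact (s1.isCompact.union s2.isCompact).of_isClosed_subset (isClosed_tsupport _) key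

theorem setInt_ind {n : ℕ} {A : Set (Rn n)} (hA : IsOpen A) (u D : Rn n → ℝ) :
    ∫ x in A, u x * D x = ∫ x, A.indicator u x * D x := by
  rw [← integral_indicator hA.measurableSet]
  congr 1; ext x
  by_cases hx : x ∈ A <;> simp [hx]

theorem setInt_supp {n : ℕ} {A : Set (Rn n)} {η : Rn n → Rn n}
    (hη : tsupport η ⊆ A) (F : Rn n → ℝ) :
    ∫ x in A, F x * divN η x = ∫ x, F x * divN η x := by
  refine setIntegral_eq_integral_of_forall_compl_eq_zero fun x hx => ?_
  rw [divN_zero_of_notMem fun h => hx (hη h), mul_zero]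

theorem split_mol {n : ℕ} {φ : Rn n → ℝ} {A : Set (Rn n)} (hA : IsOpen A)
    {u : Rn n → ℝ} (hu : IntegrableOn u A) {M : ℝ} (hM : Bd φ A u M) {ζ : Rn n → Rn n}
    (hζ : TestN A φ ζ) {K : Set (Rn n)} (hK : tsupport ζ ⊆ K) {δ : ℝ} 
    (hKA : Metric.cthickening δ K ⊆ A) (b : ContDiffBump (0 : Rn n)) (hb : b.rOut ≤ δ) :
    ∫ x, (convolution (b.normed volume) (A.indicator u) (ContinuousLinearMap.lsmul ℝ ℝ) volume) x
      * divN ζ x ≤ M := by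
  have hU : Integrable (A.indicator u) := (integrable_indicator_iff hA.measurableSet).2 hu
  have cb : Continuous (b.normed (volume : Measure (Rn n))) := b.continuous_normed
  have sb : HasCompactSupport (b.normed (volume : Measure (Rn n))) := b.hasCompactSupport_normed
  rw [fub hU cb sb (divN_cont hζ.1) (divN_cs hζ.2.1)]
  have hh := h_cont hU (divN_cont hζ.1) (divN_cs hζ.2.1)
  have e : M = ∫ t, b.normed volume t * M := by
    rw [integral_mul_const, b.integral_normed, one_mul]
  rw [e]
  refine integral_mono ((cb.mul hh).integrable_of_hasCompactSupport sb.mul_right)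
    ((cb.integrable_of_hasCompactSupport sb).mul_const _) fun t => ?_
  dsimp only
  by_cases ht : t ∈ Metric.ball (0 : Rn n) b.rOut
  · refine mul_le_mul_of_nonneg_left ?_ (b.nonneg_normed t)
    have e2 : ∀ x, divN ζ (x + t) = divN (fun y => ζ (y + t)) x := fun x => (divN_shift t ζ x).symm
    simp only [e2]
    rw [← setInt_ind hA]
    apply hM
    obtain ⟨c1, s1, t1, b1⟩ := hζ
    refine ⟨c1.comp (contDiff_id.add contDiff_const), s1.comp_homeomorph (Homeomorph.addRight t), ?_, fun x => b1 _⟩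
    have := tsupport_comp_eq_preimage ζ (Homeomorph.addRight t)
    have h2 : tsupport (fun y => ζ (y + t)) = _ := this
    rw [h2]
    intro y hy
    apply hKA
    refine Metric.mem_cthickening_of_dist_le y (y + t) δ K (hK hy) ?_
    have : ‖t‖ < b.rOut := by simpa using ht
    simp [dist_eq_norm]; linarith
  · have : b.normed volume t = 0 := by
      have := b.support_normed_eq (μ := volume)
      by_contra hne
      exact ht (this ▸ hne)
    simp [this]

theorem split {n : ℕ} {φ : Rn n → ℝ} (hc : ConvexOn ℝ univ φ) {A : Set (Rn n)} (hA : IsOpen A)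
    {u : Rn n → ℝ} (hu : IntegrableOn u A) {M : ℝ} (hM : Bd φ A u M) {H : ℝ → ℝ} {B : ℝ}
    (hH : ContDiff ℝ 2 H) (hB : ∀ t, |H t| ≤ B) (hd0 : ∀ t, 0 ≤ deriv H t) (hd1 : ∀ t, deriv H t ≤ 1)
    {η ζ : Rn n → Rn n} (hη : TestN A φ η) (hζ : TestN A φ ζ) :
    (∫ x in A, H (u x) * divN η x) + ∫ x in A, (u x - H (u x)) * divN ζ x ≤ M := by
  have hU : Integrable (A.indicator u) := (integrable_indicator_iff hA.measurableSet).2 hu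
  set U := A.indicator u with hUdef
  have hg : ContDiff ℝ 1 (deriv H) := by
    have : ContDiff ℝ (1 + 1) H := by simpa [one_add_one_eq_two] using hH
    exact (contDiff_succ_iff_deriv.1 this).2.2
  have hHd : ∀ t, HasDerivAt H (deriv H t) t := fun t =>
    (hH.differentiable two_ne_zero t).hasDerivAt
  have hHc : Continuous H := hH.continuous
  have hKc : IsCompact (tsupport η ∪ tsupport ζ) := hη.2.1.isCompact.union hζ.2.1.isCompact
  obtain ⟨δ, hδ, hKA⟩ := hKc.exists_cthickening_subset_open hA (union_subset hη.2.2.1 hζ.2.2.1)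
  let b : ℕ → ContDiffBump (0 : Rn n) := fun k =>
    ⟨1 / ((k:ℝ) + 1), 2 * (1 / ((k:ℝ) + 1)), by positivity, by
      have : 0 < 1 / ((k:ℝ) + 1) := by positivity
      linarith⟩
  have hr : Tendsto (fun k => (b k).rOut) atTop (𝓝 0) := by
    have := (tendsto_one_div_add_atTop_nhds_zero_nat (𝕜 := ℝ)).const_mul 2
    rw [mul_zero] at this
    exact this
  let f : ℕ → Rn n → ℝ := fun k =>
    convolution ((b k).normed volume) U (ContinuousLinearMap.lsmul ℝ ℝ) volume
  have hf : ∀ k, ContDiff ℝ 1 (f k) := fun k =>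
    ((b k).hasCompactSupport_normed).contDiff_convolution_left _ ((b k).contDiff_normed) hU.locallyIntegrable
  have hae : ∀ᵐ x, Tendsto (fun k => f k x) atTop (𝓝 (U x)) :=
    ContDiffBump.ae_convolution_tendsto_right_of_locallyIntegrable (K := 2) hr
      (.of_forall fun k => le_rfl) hU.locallyIntegrable
  have iη : Integrable (divN η) := (divN_cont hη.1).integrable_of_hasCompactSupport (divN_cs hη.2.1)
  have iζ : Integrable (divN ζ) := (divN_cont hζ.1).integrable_of_hasCompactSupport (divN_cs hζ.2.1)
  -- the identity for smooth functions
  have hineq : ∀ᶠ k in atTop, (∫ x, H (f k x) * (divN η x - divN ζ x)) + ∫ x, f k x * divN ζ x ≤ M := by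
    filter_upwards [hr.eventually (gt_mem_nhds hδ)] with k hk
    have hcomb := TestN.comb hc hη hζ (a := fun x => deriv H (f k x)) (hg.comp (hf k))
      (fun x => hd0 _) (fun x => hd1 _)
    have h1 := split_mol hA hu hM hcomb.1 hcomb.2 hKA (b k) hk.le
    have hg2 : ContDiff ℝ 1 fun t => 1 - deriv H t := contDiff_const.sub hg
    have e1 := chain_divN (hf k) hη.1 hη.2.1 hg hHd
    have e2 := chain_divN (H := fun t => t - H t) (hf k) hζ.1 hζ.2.1 hg2
      (fun t => (hasDerivAt_id t).sub (hHd t))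
    have c1 : ContDiff ℝ 1 fun y => deriv H (f k y) • η y := (hg.comp (hf k)).smul hη.1
    have c2 : ContDiff ℝ 1 fun y => (1 - deriv H (f k y)) • ζ y := (hg2.comp (hf k)).smul hζ.1
    have s1 : HasCompactSupport fun y => deriv H (f k y) • η y :=
      HasCompactSupport.intro hη.2.1 fun x hx => by simp [image_eq_zero_of_notMem_tsupport hx]
    have s2 : HasCompactSupport fun y => (1 - deriv H (f k y)) • ζ y :=
      HasCompactSupport.intro hζ.2.1 fun x hx => by simp [image_eq_zero_of_notMem_tsupport hx]
    have J : ∀ (F : Rn n → ℝ) (θ : Rn n → Rn n), Continuous F → ContDiff ℝ 1 θ → HasCompactSupport θ →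
        Integrable fun x => F x * divN θ x := fun F θ hF hθ hθ' =>
      (hF.mul (divN_cont hθ)).integrable_of_hasCompactSupport (divN_cs hθ').mul_left
    have fc := (hf k).continuous
    have Hc : Continuous fun x => H (f k x) := hHc.comp fc
    simp only [divN_add c1 c2, mul_add] at h1
    rw [integral_add (J _ _ fc c1 s1) (J _ _ fc c2 s2)] at h1
    have e1' : ∫ x, f k x * divN (fun y => deriv H (f k y) • η y) x = ∫ x, H (f k x) * divN η x := e1
    have e2' : ∫ x, f k x * divN (fun y => (1 - deriv H (f k y)) • ζ y) x
      = ∫ x, (f k x - H (f k x)) * divN ζ x := e2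
    have h1' : (∫ x, f k x * divN (fun y => deriv H (f k y) • η y) x) +
      ∫ x, f k x * divN (fun y => (1 - deriv H (f k y)) • ζ y) x ≤ M := h1
    rw [e1', e2'] at h1'
    simp only [sub_mul, mul_sub] at h1' ⊢
    rw [integral_sub (J _ _ fc hζ.1 hζ.2.1) (J _ _ Hc hζ.1 hζ.2.1)] at h1'
    rw [integral_sub (J _ _ Hc hη.1 hη.2.1) (J _ _ Hc hζ.1 hζ.2.1)]
    linarith
  have lim1 : Tendsto (fun k => ∫ x, H (f k x) * (divN η x - divN ζ x)) atTop
      (𝓝 (∫ x, H (U x) * (divN η x - divN ζ x))) := by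
    refine tendsto_integral_of_dominated_convergence (fun x => B * ‖divN η x - divN ζ x‖) ?_
      ((iη.sub iζ).norm.const_mul B) ?_ ?_
    · intro k
      have := (hf k).continuous
      have := divN_cont hη.1
      have := divN_cont hζ.1
      exact Continuous.aestronglyMeasurable (by fun_prop)
    · intro k
      refine .of_forall fun x => ?_
      rw [norm_mul]
      exact mul_le_mul_of_nonneg_right (hB _) (norm_nonneg _)
    · filter_upwards [hae] with x hx
      exact ((hHc.tendsto _).comp hx).mul_const _
  have lim2 : Tendsto (fun k => ∫ x, f k x * divN ζ x) atTop (𝓝 (∫ x, U x * divN ζ x)) := by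
    have hh := h_cont hU (divN_cont hζ.1) (divN_cs hζ.2.1)
    have hh' : Continuous fun t => ∫ x, U x * divN ζ (x + -t) := hh.comp continuous_neg
    have := ContDiffBump.convolution_tendsto_right_of_continuous (μ := volume) hr hh' 0
    simp only [neg_zero, add_zero] at this
    refine this.congr fun k => ?_
    have := fub hU ((b k).continuous_normed (μ := volume)) (b k).hasCompactSupport_normed
      (divN_cont hζ.1) (divN_cs hζ.2.1)
    rw [convolution_def]
    simp only [zero_sub, neg_neg]
    exact this.symm
  have fin := le_of_tendsto (lim1.add lim2) hineq
  have hHu : Integrable (fun x => H (U x) * (divN η x - divN ζ x)) := by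
    refine Integrable.bdd_mul (c := B) (iη.sub iζ) (hHc.comp_aestronglyMeasurable hU.aestronglyMeasurable) (.of_forall fun x => hB _)
  have hHu1 : Integrable (fun x => H (U x) * divN η x) :=
    Integrable.bdd_mul (c := B) iη (hHc.comp_aestronglyMeasurable hU.aestronglyMeasurable) (.of_forall fun x => hB _)
  have hHu2 : Integrable (fun x => H (U x) * divN ζ x) :=
    Integrable.bdd_mul (c := B) iζ (hHc.comp_aestronglyMeasurable hU.aestronglyMeasurable) (.of_forall fun x => hB _)
  have e1 : ∫ x in A, H (u x) * divN η x = ∫ x, H (U x) * divN η x := by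
    rw [← setInt_supp hη.2.2.1 fun x => H (U x)]
    exact setIntegral_congr_fun hA.measurableSet fun x hx => by simp [U, hx]
  have e2 : ∫ x in A, (u x - H (u x)) * divN ζ x = ∫ x, (U x - H (U x)) * divN ζ x := by
    rw [← setInt_supp hζ.2.2.1 fun x => U x - H (U x)]
    exact setIntegral_congr_fun hA.measurableSet fun x hx => by simp [U, hx]
  rw [e1, e2]
  simp only [sub_mul, mul_sub] at fin ⊢
  rw [integral_sub hHu1 hHu2] at fin
  rw [integral_sub (int_divN hU hζ.1 hζ.2.1) hHu2]
  linarith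


theorem Bd.change {n : ℕ} {Ψ Ψ' : Rn n → ℝ} {A : Set (Rn n)} {u : Rn n → ℝ} {M r : ℝ} (hr : 0 < r)
    (h : ∀ x, Ψ' x ≤ 1 → Ψ (r • x) ≤ 1) (hM : Bd Ψ A u M) : Bd Ψ' A u (M / r) := by
  intro η hη
  obtain ⟨c, s, t, b⟩ := hη
  have hts : tsupport (fun x => r • η x) ⊆ tsupport η := by
    refine closure_minimal ?_ (isClosed_tsupport _)
    intro x hx
    by_contra hh
    exact hx (by simp [image_eq_zero_of_notMem_tsupport hh])
  have := hM (fun x => r • η x) ⟨c.const_smul r, s.of_isClosed_subset (isClosed_tsupport _) hts,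
    hts.trans t, fun x => h _ (b x)⟩
  simp only [divN_const_smul r c] at this
  rw [le_div_iff₀ hr, ← integral_mul_const]
  refine le_trans (le_of_eq ?_) this
  congr 1; ext x; ring

theorem IsNormN.zero {n : ℕ} {φ : Rn n → ℝ} (h : IsNormN φ) : φ 0 = 0 := by
  have := h.2.1 0 0
  simpa using this

theorem IsNormN.upper {n : ℕ} {φ : Rn n → ℝ} (h : IsNormN φ) :
    ∃ R > (0:ℝ), ∀ x, φ x ≤ 1 → ‖x‖ ≤ R := by
  obtain ⟨c, hc, hx⟩ := h.2.2
  refine ⟨1 / c, by positivity, fun x h1 => ?_⟩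
  rw [le_div_iff₀ hc, mul_comm]
  exact (hx x).trans h1

theorem IsNormN.lower {n : ℕ} {φ : Rn n → ℝ} (h : IsNormN φ) :
    ∃ r > (0:ℝ), ∀ x, ‖x‖ ≤ 1 → φ (r • x) ≤ 1 := by
  have hc : Continuous φ := h.1.locallyLipschitz.continuous
  have h0 : ∀ᶠ x in 𝓝 (0 : Rn n), φ x < 1 :=
    hc.continuousAt.eventually (gt_mem_nhds (by rw [h.zero]; exact one_pos))
  obtain ⟨ε, hε, hb⟩ := Metric.eventually_nhds_iff.1 h0
  refine ⟨ε / 2, by positivity, fun x hx => (hb ?_).le⟩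
  rw [dist_zero_right, norm_smul, Real.norm_of_nonneg (by positivity)]
  nlinarith

theorem bv_iff {n : ℕ} {φ : Rn n → ℝ} (h : IsNormN φ) {Ω : Set (Rn n)} {u : Rn n → ℝ} :
    BVlocFun Ω u ↔ ∀ A, CpCtd A Ω → IntegrableOn u A ∧ ∃ M, Bd φ A u M := by
  obtain ⟨R, hR, hu⟩ := h.upper
  obtain ⟨r, hr, hl⟩ := h.lower
  constructor
  · rintro ⟨h1, h2⟩ A hA
    refine ⟨h1 A hA, ?_⟩
    obtain ⟨M, hM⟩ := h2 A hA
    have : Bd (fun x => ‖x‖) A u M := fun η hη => hM ⟨η, hη, rfl⟩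
    refine ⟨_, this.change (r := R⁻¹) (by positivity) fun x hx => ?_⟩
    simp only [norm_smul, norm_inv, Real.norm_of_nonneg hR.le]
    rw [inv_mul_le_iff₀ hR]; simpa using hu x hx
  · intro H
    refine ⟨fun A hA => (H A hA).1, fun A hA => ?_⟩
    obtain ⟨M, hM⟩ := (H A hA).2
    refine ⟨M / r, ?_⟩
    rintro _ ⟨η, hη, rfl⟩
    exact hM.change (Ψ' := fun x => ‖x‖) hr hl η hη

theorem sup_sum {ι : Type*} {P : ι → Prop} (hne : ∃ i, P i) {a b : ι → ℝ} {M : ℝ}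
    (h : ∀ i j, P i → P j → a i + b j ≤ M) :
    ∃ s, (∀ i, P i → a i ≤ s) ∧ ∀ j, P j → b j ≤ M - s := by
  obtain ⟨i0, h0⟩ := hne
  have hb : BddAbove (a '' {i | P i}) := by
    refine ⟨M - b i0, ?_⟩
    rintro _ ⟨i, hi, rfl⟩
    linarith [h i i0 hi h0]
  refine ⟨sSup (a '' {i | P i}), fun i hi => le_csSup hb ⟨i, hi, rfl⟩, fun j hj => ?_⟩
  have : sSup (a '' {i | P i}) ≤ M - b j := by
    refine csSup_le ⟨_, ⟨i0, h0, rfl⟩⟩ ?_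
    rintro _ ⟨i, hi, rfl⟩
    linarith [h i j hi hj]
  linarith

theorem testZero {n : ℕ} {φ : Rn n → ℝ} (h : IsNormN φ) (A : Set (Rn n)) :
    TestN A φ (fun _ => 0) := by
  refine ⟨contDiff_const, HasCompactSupport.zero, ?_, fun x => by rw [h.zero]; exact zero_le_one⟩
  have : tsupport (fun _ : Rn n => (0 : Rn n)) = ∅ := tsupport_eq_empty_iff.2 rfl
  rw [this]; exact empty_subset _

theorem divN_zero {n : ℕ} (x : Rn n) : divN (fun _ => (0 : Rn n)) x = 0 := by
  simp [divN]

theorem lubV {n : ℕ} {φ : Rn n → ℝ} (h : IsNormN φ) {A : Set (Rn n)} {u : Rn n → ℝ} {M0 : ℝ}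
    (hM : Bd φ A u M0) : ∃ S, Bd φ A u S ∧ ∀ M, Bd φ A u M → S ≤ M := by
  have hb : BddAbove {r | ∃ η, TestN A φ η ∧ r = ∫ x in A, u x * divN η x} :=
    ⟨M0, by rintro _ ⟨η, hη, rfl⟩; exact hM η hη⟩
  refine ⟨sSup {r | ∃ η, TestN A φ η ∧ r = ∫ x in A, u x * divN η x},
    fun η hη => le_csSup hb ⟨η, hη, rfl⟩, fun M hM => csSup_le ⟨_, _, testZero h A, rfl⟩ ?_⟩
  rintro _ ⟨η, hη, rfl⟩; exact hM η hη

theorem Bd.add {n : ℕ} {φ : Rn n → ℝ} {A : Set (Rn n)} {u v : Rn n → ℝ} {M N : ℝ}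
    (hu : IntegrableOn u A) (hv : IntegrableOn v A) (hM : Bd φ A u M) (hN : Bd φ A v N) :
    Bd φ A (fun x => u x + v x) (M + N) := by
  intro η hη
  simp only [add_mul]
  rw [integral_add (int_divN hu hη.1 hη.2.1) (int_divN hv hη.1 hη.2.1)]
  exact add_le_add (hM η hη) (hN η hη)

theorem bv_add {n : ℕ} {φ : Rn n → ℝ} (h : IsNormN φ) {Ω : Set (Rn n)} {u v : Rn n → ℝ}
    (hu : BVlocFun Ω u) (hv : BVlocFun Ω v) : BVlocFun Ω (fun x => u x + v x) := by
  rw [bv_iff h] at *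
  intro A hA
  obtain ⟨i1, M, hM⟩ := hu A hA
  obtain ⟨i2, N, hN⟩ := hv A hA
  exact ⟨i1.add i2, _, hM.add i1 i2 hN⟩

theorem finA {n : ℕ} {A Ω : Set (Rn n)} (hA : CpCtd A Ω) : volume A < ⊤ :=
  (measure_mono subset_closure).trans_lt hA.2.1.measure_lt_top

theorem int_bdd {n : ℕ} {A Ω : Set (Rn n)} (hA : CpCtd A Ω) {w : Rn n → ℝ} {B : ℝ}
    (hw : AEStronglyMeasurable w (volume.restrict A)) (hB : ∀ x, |w x| ≤ B) : IntegrableOn w A := by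
  have : IsFiniteMeasure (volume.restrict A) := ⟨by simpa using finA hA⟩
  exact Integrable.of_bound hw B (.of_forall hB)

theorem bv_comp {n : ℕ} {φ : Rn n → ℝ} (h : IsNormN φ) {Ω : Set (Rn n)} {u : Rn n → ℝ}
    (hu : BVlocFun Ω u) {H : ℝ → ℝ} {B : ℝ}
    (hH : ContDiff ℝ 2 H) (hB : ∀ t, |H t| ≤ B) (hd0 : ∀ t, 0 ≤ deriv H t) (hd1 : ∀ t, deriv H t ≤ 1) :
    BVlocFun Ω (fun x => H (u x)) ∧ BVlocFun Ω (fun x => u x - H (u x)) := by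
  rw [bv_iff h] at hu
  have key : ∀ A, CpCtd A Ω → IntegrableOn (fun x => H (u x)) A := fun A hA =>
    int_bdd hA (hH.continuous.comp_aestronglyMeasurable (hu A hA).1.aestronglyMeasurable) fun x => hB _
  constructor
  · rw [bv_iff h]
    intro A hA
    obtain ⟨i1, M, hM⟩ := hu A hA
    refine ⟨key A hA, M, fun η hη => ?_⟩
    have := split h.1 hA.1 i1 hM hH hB hd0 hd1 hη (testZero h A)
    simpa [divN_zero] using this
  · rw [bv_iff h]
    intro A hA
    obtain ⟨i1, M, hM⟩ := hu A hA
    refine ⟨i1.sub (key A hA), M, fun η hη => ?_⟩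
    have := split h.1 hA.1 i1 hM hH hB hd0 hd1 (testZero h A) hη
    simpa [divN_zero] using this

def MinV {n : ℕ} (φ : Rn n → ℝ) (Ω : Set (Rn n)) (u : Rn n → ℝ) : Prop :=
  BVlocFun Ω u ∧ ∀ A, CpCtd A Ω → ∀ v, BVlocFun Ω v →
    CptSupp A (fun x => u x - v x) → ∀ M, Bd φ A v M → Bd φ A u M

theorem min_comp {n : ℕ} {φ : Rn n → ℝ} (h : IsNormN φ) {Ω : Set (Rn n)} {u : Rn n → ℝ}
    (hu : MinV φ Ω u) {H : ℝ → ℝ} {B : ℝ}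
    (hH : ContDiff ℝ 2 H) (hB : ∀ t, |H t| ≤ B) (hd0 : ∀ t, 0 ≤ deriv H t) (hd1 : ∀ t, deriv H t ≤ 1) :
    MinV φ Ω (fun x => H (u x)) := by
  obtain ⟨b1, b2⟩ := bv_comp h hu.1 hH hB hd0 hd1
  refine ⟨b1, fun A hA v hv hs M hM => ?_⟩
  obtain ⟨iu, M0, hM0⟩ := (bv_iff h).1 hu.1 A hA
  obtain ⟨S, hS, hS'⟩ := lubV h hM0
  obtain ⟨s, hs1, hs2⟩ := sup_sum (P := TestN A φ) ⟨_, testZero h A⟩ fun η ζ hη hζ =>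
    split h.1 hA.1 iu hS hH hB hd0 hd1 hη hζ
  have hw : Bd φ A (fun x => (u x - H (u x)) + v x) (S - s + M) :=
    Bd.add ((bv_iff h).1 b2 A hA).1 ((bv_iff h).1 hv A hA).1 hs2 hM
  have := hS' _ (hu.2 A hA _ (bv_add h b2 hv) (by
    have e : (fun x => u x - (u x - H (u x) + v x)) = fun x => H (u x) - v x := by ext x; ring
    rw [e]; exact hs) _ hw)
  intro η hη
  linarith [hs1 η hη]

theorem min_smul {n : ℕ} {φ : Rn n → ℝ} (h : IsNormN φ) {Ω : Set (Rn n)} {u : Rn n → ℝ}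
    (hu : MinV φ Ω u) {c : ℝ} (hc : 0 < c) : MinV φ Ω (fun x => c * u x) := by
  have sc : ∀ {c : ℝ}, 0 < c → ∀ {A : Set (Rn n)} {w : Rn n → ℝ} {M : ℝ}, Bd φ A w M →
      Bd φ A (fun x => c * w x) (c * M) := by
    intro c hc A w M hM η hη
    simp only [mul_assoc]
    rw [integral_const_mul]
    exact mul_le_mul_of_nonneg_left (hM η hη) hc.le
  have bsc : ∀ {c : ℝ}, 0 < c → ∀ {w : Rn n → ℝ}, BVlocFun Ω w → BVlocFun Ω (fun x => c * w x) := by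
    intro c hc w hw
    rw [bv_iff h] at *
    intro A hA
    obtain ⟨i, M, hM⟩ := hw A hA
    exact ⟨i.const_mul c, _, sc hc hM⟩
  refine ⟨bsc hc hu.1, fun A hA v hv hs M hM => ?_⟩
  have hci : 0 < c⁻¹ := by positivity
  have := hu.2 A hA _ (bsc hci hv) (by
    have e : Function.support (fun x => u x - c⁻¹ * v x) ⊆ Function.support (fun x => c * u x - v x) := by
      intro x hx hx'
      apply hx
      simp only at hx' ⊢
      field_simp
      linarith
    exact ⟨hs.1.of_isClosed_subset (isClosed_tsupport _) (closure_mono e), (closure_mono e).trans hs.2⟩) _ (sc hci hM)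
  have h2 := sc hc this
  rwa [mul_inv_cancel_left₀ hc.ne'] at h2


theorem grad_bdd {n : ℕ} {ψ : Rn n → ℝ} {η : Rn n → Rn n} (hψ : ContDiff ℝ 1 ψ)
    (hη : ContDiff ℝ 1 η) (hη' : HasCompactSupport η) :
    Continuous (fun x => fderiv ℝ ψ x (η x)) ∧ HasCompactSupport (fun x => fderiv ℝ ψ x (η x)) := by
  refine ⟨(hψ.continuous_fderiv one_ne_zero).clm_apply hη.continuous, ?_⟩
  exact HasCompactSupport.intro hη' fun x hx => by simp [image_eq_zero_of_notMem_tsupport hx]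

theorem grad_int {n : ℕ} {ψ v : Rn n → ℝ} {η : Rn n → Rn n} {μ : Measure (Rn n)}
    (hv : Integrable v μ) (hψ : ContDiff ℝ 1 ψ)
    (hη : ContDiff ℝ 1 η) (hη' : HasCompactSupport η) :
    Integrable (fun x => v x * fderiv ℝ ψ x (η x)) μ := by
  obtain ⟨c, s⟩ := grad_bdd hψ hη hη'
  obtain ⟨C, hC⟩ := s.exists_bound_of_continuous c
  exact hv.mul_bdd (c := C) c.aestronglyMeasurable (.of_forall hC)

theorem smul_cs {n : ℕ} {ψ : Rn n → ℝ} {η : Rn n → Rn n} (hη' : HasCompactSupport η) :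
    HasCompactSupport (fun x => ψ x • η x) :=
  HasCompactSupport.intro hη' fun x hx => by simp [image_eq_zero_of_notMem_tsupport hx]

theorem prodI {n : ℕ} {ψ v : Rn n → ℝ} {η : Rn n → Rn n} {μ : Measure (Rn n)}
    (hv : Integrable v μ) (hψ : ContDiff ℝ 1 ψ)
    (hη : ContDiff ℝ 1 η) (hη' : HasCompactSupport η) :
    ∫ x, (ψ x * v x) * divN η x ∂μ =
      (∫ x, v x * divN (fun y => ψ y • η y) x ∂μ) - ∫ x, v x * fderiv ℝ ψ x (η x) ∂μ := by
  have c : ContDiff ℝ 1 fun y => ψ y • η y := hψ.smul hη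
  rw [← integral_sub (int_divN hv c (smul_cs hη')) (grad_int hv hψ hη hη')]
  congr 1; ext x
  rw [divN_smul hψ hη]; ring

theorem TestN.mul {n : ℕ} {φ : Rn n → ℝ} (h : IsNormN φ) {A : Set (Rn n)}
    {η : Rn n → Rn n} (hη : TestN A φ η) {a : Rn n → ℝ} (ha : ContDiff ℝ 1 a)
    (h0 : ∀ x, 0 ≤ a x) (h1 : ∀ x, a x ≤ 1) : TestN A φ (fun x => a x • η x) := by
  have := (TestN.comb h.1 hη (testZero h A) ha h0 h1).1
  simpa using this

theorem grad_est {n : ℕ} {φ : Rn n → ℝ} {ψ v : Rn n → ℝ} {η : Rn n → Rn n} {μ : Measure (Rn n)}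
    {R L : ℝ} (hR : ∀ x, φ x ≤ 1 → ‖x‖ ≤ R) (hφ : ∀ x, φ (η x) ≤ 1)
    (hv : Integrable v μ) (hψ : ContDiff ℝ 1 ψ) (hL : ∀ x, ‖fderiv ℝ ψ x‖ ≤ L) :
    |∫ x, v x * fderiv ℝ ψ x (η x) ∂μ| ≤ ∫ x, |v x| * (R * ‖fderiv ℝ ψ x‖) ∂μ := by
  rw [← Real.norm_eq_abs]
  have R0 : 0 ≤ R := (norm_nonneg _).trans (hR _ (hφ 0))
  have hc := hψ.continuous_fderiv one_ne_zero
  refine norm_integral_le_of_norm_le ?_ (.of_forall fun x => ?_)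
  · refine Integrable.mul_bdd (c := R * L) hv.abs (by fun_prop) (.of_forall fun x => ?_)
    rw [norm_mul, norm_norm, Real.norm_of_nonneg R0]
    exact mul_le_mul_of_nonneg_left (hL x) R0
  · rw [norm_mul, Real.norm_eq_abs]
    refine mul_le_mul_of_nonneg_left ?_ (abs_nonneg _)
    refine ((fderiv ℝ ψ x).le_opNorm _).trans ?_
    rw [mul_comm]
    exact mul_le_mul_of_nonneg_right (hR _ (hφ x)) (norm_nonneg _)

theorem bv_mul {n : ℕ} {φ : Rn n → ℝ} (h : IsNormN φ) {Ω : Set (Rn n)} {v ψ : Rn n → ℝ}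
    (hv : BVlocFun Ω v) (hψ : ContDiff ℝ 1 ψ) (h0 : ∀ x, 0 ≤ ψ x) (h1 : ∀ x, ψ x ≤ 1) {L : ℝ}
    (hL : ∀ x, ‖fderiv ℝ ψ x‖ ≤ L) : BVlocFun Ω (fun x => ψ x * v x) := by
  obtain ⟨R, hR0, hR⟩ := h.upper
  rw [bv_iff h] at *
  intro A hA
  obtain ⟨i, M, hM⟩ := hv A hA
  refine ⟨?_, M + ∫ x in A, |v x| * (R * ‖fderiv ℝ ψ x‖), fun η hη => ?_⟩
  · refine Integrable.bdd_mul (c := 1) i hψ.continuous.aestronglyMeasurable (.of_forall fun x => ?_)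
    rw [Real.norm_of_nonneg (h0 x)]; exact h1 x
  · rw [prodI i hψ hη.1 hη.2.1]
    have e1 := hM _ (hη.mul h hψ h0 h1)
    have e2 := abs_le.1 (grad_est (v := v) (μ := volume.restrict A) hR hη.2.2.2 i hψ hL)
    linarith [e2.1]

theorem cut {n : ℕ} {φ : Rn n → ℝ} (h : IsNormN φ) {Ω : Set (Rn n)} {u v ψ : Rn n → ℝ}
    (hu : MinV φ Ω u) (hv : BVlocFun Ω v) {A : Set (Rn n)} (hA : CpCtd A Ω)
    (hψ : ContDiff ℝ 1 ψ) (h0 : ∀ x, 0 ≤ ψ x) (h1 : ∀ x, ψ x ≤ 1) {L : ℝ}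
    (hL : ∀ x, ‖fderiv ℝ ψ x‖ ≤ L) (hψc : HasCompactSupport ψ) (hψA : tsupport ψ ⊆ A)
    {R : ℝ} (hR : ∀ x, φ x ≤ 1 → ‖x‖ ≤ R) {B : ℝ}
    (hB : ∀ η, TestN A φ η → ∫ x in A, v x * divN (fun y => ψ y • η y) x ≤ B)
    {η : Rn n → Rn n} (hη : TestN A φ η) :
    ∫ x in A, u x * divN (fun y => ψ y • η y) x ≤
      B + ∫ x in A, |v x - u x| * (R * ‖fderiv ℝ ψ x‖) := by
  obtain ⟨iu, M0, hM0⟩ := (bv_iff h).1 hu.1 A hA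
  obtain ⟨iv, -⟩ := (bv_iff h).1 hv A hA
  obtain ⟨S, hS, hS'⟩ := lubV h hM0
  have hψ' : ContDiff ℝ 1 fun x => 1 - ψ x := contDiff_const.sub hψ
  have fd : ∀ x, fderiv ℝ (fun x => 1 - ψ x) x = - fderiv ℝ ψ x := fun x => by
    rw [fderiv_const_sub]
  have h0' : ∀ x, 0 ≤ 1 - ψ x := fun x => sub_nonneg.2 (h1 x)
  have h1' : ∀ x, 1 - ψ x ≤ 1 := fun x => by linarith [h0 x]
  obtain ⟨s, hs1, hs2⟩ := sup_sum (P := TestN A φ) ⟨_, testZero h A⟩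
    (a := fun η => ∫ x in A, u x * divN (fun y => ψ y • η y) x)
    (b := fun η => ∫ x in A, u x * divN (fun y => (1 - ψ y) • η y) x) (M := S) fun η ζ hη hζ => by
      have c1 : ContDiff ℝ 1 fun y => ψ y • η y := hψ.smul hη.1
      have c2 : ContDiff ℝ 1 fun y => (1 - ψ y) • ζ y := hψ'.smul hζ.1
      have := hS _ (TestN.comb h.1 hη hζ hψ h0 h1).1
      simp only [divN_add c1 c2, mul_add] at this
      rwa [integral_add (int_divN iu c1 (smul_cs hη.2.1)) (int_divN iu c2 (smul_cs hζ.2.1))] at this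
  have bw : BVlocFun Ω fun x => ψ x * v x + (1 - ψ x) * u x :=
    bv_add h (bv_mul h hv hψ h0 h1 hL) (bv_mul h hu.1 hψ' h0' h1' (L := L) fun x => by
      rw [fd, norm_neg]; exact hL x)
  have hw := hu.2 A hA _ bw (by
    have e : tsupport (fun x => u x - (ψ x * v x + (1 - ψ x) * u x)) ⊆ tsupport ψ := by
      refine closure_mono fun x hx hx' => hx ?_
      simp [hx']
    exact ⟨hψc.of_isClosed_subset (isClosed_tsupport _) e, e.trans hψA⟩)
    (B + (S - s) + ∫ x in A, |v x - u x| * (R * ‖fderiv ℝ ψ x‖)) (by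
    intro η hη
    have i1 : IntegrableOn (fun x => ψ x * v x) A := by
      refine Integrable.bdd_mul (c := 1) iv hψ.continuous.aestronglyMeasurable (.of_forall fun x => ?_)
      rw [Real.norm_of_nonneg (h0 x)]; exact h1 x
    have i2 : IntegrableOn (fun x => (1 - ψ x) * u x) A := by
      refine Integrable.bdd_mul (c := 1) iu hψ'.continuous.aestronglyMeasurable (.of_forall fun x => ?_)
      rw [Real.norm_of_nonneg (h0' x)]; exact h1' x
    simp only [add_mul]
    rw [integral_add (int_divN i1 hη.1 hη.2.1) (int_divN i2 hη.1 hη.2.1), prodI iv hψ hη.1 hη.2.1,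
      prodI iu hψ' hη.1 hη.2.1]
    have e1 := hB η hη
    have e2 := hs2 η hη
    have e3 := abs_le.1 (grad_est (v := fun x => v x - u x) (μ := volume.restrict A) hR hη.2.2.2 (iv.sub iu) hψ hL)
    have e4 : ∫ x in A, (v x - u x) * fderiv ℝ ψ x (η x) = (∫ x in A, v x * fderiv ℝ ψ x (η x)) -
        ∫ x in A, u x * fderiv ℝ ψ x (η x) := by
      rw [← integral_sub (grad_int iv hψ hη.1 hη.2.1) (grad_int iu hψ hη.1 hη.2.1)]
      simp only [sub_mul]
    have e5 : ∫ x in A, u x * fderiv ℝ (fun x => 1 - ψ x) x (η x) = - ∫ x in A, u x * fderiv ℝ ψ x (η x) := by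
      rw [← integral_neg]
      simp [fd]
    rw [e5]
    linarith [e3.1])
  have := hS' _ hw
  linarith [hs1 η hη]

theorem exists_cutoff {n : ℕ} {K A : Set (Rn n)} (hK : IsCompact K) (hA : IsOpen A) (hKA : K ⊆ A) :
    ∃ ψ : Rn n → ℝ, ContDiff ℝ 1 ψ ∧ (∀ x, 0 ≤ ψ x) ∧ (∀ x, ψ x ≤ 1) ∧ HasCompactSupport ψ ∧
      tsupport ψ ⊆ A ∧ (∀ x ∈ K, ∀ᶠ y in 𝓝 x, ψ y = 1) ∧ ∃ L, ∀ x, ‖fderiv ℝ ψ x‖ ≤ L := by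
  obtain ⟨K', hK', h1, h2⟩ := exists_compact_between hK hA hKA
  obtain ⟨f, f1, f2, f3⟩ := exists_contMDiffMap_one_nhds_of_subset_interior (n := 1)
    (modelWithCornersSelf ℝ (Rn n)) hK.isClosed h1
  have hc : ContDiff ℝ 1 f := f.contMDiff.contDiff
  have ts : tsupport f ⊆ K' := closure_minimal (fun x hx => by
    by_contra hh; exact hx (f2 x hh)) hK'.isClosed
  have cs : HasCompactSupport f := hK'.of_isClosed_subset (isClosed_tsupport _) ts
  refine ⟨f, hc, fun x => (f3 x).1, fun x => (f3 x).2, cs, ts.trans h2, fun x hx => ?_, ?_⟩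
  · exact mem_nhdsSet_iff_forall.1 f1 x hx
  · exact (cs.fderiv ℝ).exists_bound_of_continuous (hc.continuous_fderiv one_ne_zero)


theorem lim_div {n : ℕ} {A Ω : Set (Rn n)} {w : ℕ → Rn n → ℝ} {χ : Rn n → ℝ}
    (hm : ∀ k, IntegrableOn (w k) A) (hb : ∀ k x, |w k x| ≤ 1)
    (hl : ∀ x, Tendsto (fun k => w k x) atTop (𝓝 (χ x))) {η : Rn n → Rn n}
    (hη : ContDiff ℝ 1 η) (hη' : HasCompactSupport η) :
    Tendsto (fun k => ∫ x in A, w k x * divN η x) atTop (𝓝 (∫ x in A, χ x * divN η x)) := by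
  have i : Integrable (divN η) := (divN_cont hη).integrable_of_hasCompactSupport (divN_cs hη')
  refine tendsto_integral_of_dominated_convergence (fun x => ‖divN η x‖) ?_ i.norm.integrableOn ?_ ?_
  · exact fun k => (int_divN (hm k) hη hη').aestronglyMeasurable
  · refine fun k => .of_forall fun x => ?_
    rw [norm_mul]
    exact mul_le_of_le_one_left (norm_nonneg _) (hb k x)
  · exact .of_forall fun x => (hl x).mul_const _

theorem min_limit {n : ℕ} {φ : Rn n → ℝ} (h : IsNormN φ) {Ω : Set (Rn n)} (hΩ : IsOpen Ω)
    {w : ℕ → Rn n → ℝ} {χ : Rn n → ℝ} (hmin : ∀ k, MinV φ Ω (w k)) (hb : ∀ k x, |w k x| ≤ 1)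
    (hl : ∀ x, Tendsto (fun k => w k x) atTop (𝓝 (χ x))) : MinV φ Ω χ := by
  obtain ⟨R, hR0, hR⟩ := h.upper
  have hi : ∀ k A, CpCtd A Ω → IntegrableOn (w k) A := fun k A hA => (hmin k).1.1 A hA
  have hχb : ∀ x, |χ x| ≤ 1 := fun x => le_of_tendsto (hl x).abs (.of_forall fun k => hb k x)
  have hχi : ∀ A, CpCtd A Ω → IntegrableOn χ A := fun A hA =>
    int_bdd hA (aestronglyMeasurable_of_tendsto_ae atTop (fun k => (hi k A hA).aestronglyMeasurable)
      (.of_forall hl)) hχb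
  have bv0 : BVlocFun Ω (fun _ => (0:ℝ)) := by
    rw [bv_iff h]
    exact fun A hA => ⟨integrableOn_zero, 0, fun η _ => by simp⟩
  have bvχ : BVlocFun Ω χ := by
    rw [bv_iff h]
    intro A hA
    refine ⟨hχi A hA, ?_⟩
    obtain ⟨K', hK', k1, k2⟩ := exists_compact_between hA.2.1 hΩ hA.2.2
    have hA' : CpCtd (interior K') Ω := ⟨isOpen_interior,
      hK'.of_isClosed_subset isClosed_closure (closure_minimal interior_subset hK'.isClosed),
      (closure_minimal interior_subset hK'.isClosed).trans k2⟩
    obtain ⟨ψ, c, h0, h1, cs, ts, hn, L, hL⟩ := exists_cutoff hA.2.1 isOpen_interior k1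
    refine ⟨∫ x in interior K', R * L, fun η hη => ?_⟩
    have hη2 : TestN (interior K') φ η := ⟨hη.1, hη.2.1, hη.2.2.1.trans (subset_closure.trans k1), hη.2.2.2⟩
    have e : (fun y => ψ y • η y) = η := by
      ext1 y
      by_cases hy : y ∈ tsupport η
      · rw [(hn y (subset_closure (hη.2.2.1 hy))).self_of_nhds, one_smul]
      · simp [image_eq_zero_of_notMem_tsupport hy]
    refine le_of_tendsto (lim_div (Ω := Ω) (fun k => hi k A hA) hb hl hη.1 hη.2.1) (.of_forall fun k => ?_)
    have := cut h (hmin k) bv0 hA' c h0 h1 hL cs ts hR (B := 0) (fun η _ => by simp) hη2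
    rw [e, setInt_supp hη2.2.2.1] at this
    rw [setInt_supp hη.2.2.1]
    refine this.trans ?_
    rw [zero_add]
    refine integral_mono_of_nonneg (.of_forall fun x => by positivity) ?_ (.of_forall fun x => ?_)
    · exact integrableOn_const (finA hA').ne
    · simp only [zero_sub, abs_neg]
      have hx := mul_le_mul_of_nonneg_left (hL x) hR0.le
      have : 0 ≤ R * ‖fderiv ℝ ψ x‖ := by positivity
      nlinarith [hb k x, abs_nonneg (w k x)]
  refine ⟨bvχ, fun A hA v hv hs M hM => ?_⟩
  obtain ⟨ψ, c, h0, h1, cs, ts, hn, L, hL⟩ := exists_cutoff hs.1 hA.1 hs.2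
  have iv := hv.1 A hA
  have iχ := hχi A hA
  have c' : ContDiff ℝ 1 fun x => 1 - ψ x := contDiff_const.sub c
  have hz : ∀ x, χ x - v x ≠ 0 → ∀ᶠ y in 𝓝 x, ψ y = 1 := fun x hx => hn x (subset_closure hx)
  obtain ⟨s, hs1, hs2⟩ := sup_sum (P := TestN A φ) ⟨_, testZero h A⟩
    (a := fun η => ∫ x in A, v x * divN (fun y => ψ y • η y) x)
    (b := fun η => ∫ x in A, v x * divN (fun y => (1 - ψ y) • η y) x) (M := M) fun η ζ hη hζ => by
      have c1 : ContDiff ℝ 1 fun y => ψ y • η y := c.smul hη.1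
      have c2 : ContDiff ℝ 1 fun y => (1 - ψ y) • ζ y := c'.smul hζ.1
      have := hM _ (TestN.comb h.1 hη hζ c h0 h1).1
      simp only [divN_add c1 c2, mul_add] at this
      rwa [integral_add (int_divN iv c1 (smul_cs hη.2.1)) (int_divN iv c2 (smul_cs hζ.2.1))] at this
  intro η hη
  have c1 : ContDiff ℝ 1 fun y => ψ y • η y := c.smul hη.1
  have c2 : ContDiff ℝ 1 fun y => (1 - ψ y) • η y := c'.smul hη.1
  -- the part near the perturbation
  have lim2 : Tendsto (fun k => ∫ x in A, |v x - w k x| * (R * ‖fderiv ℝ ψ x‖)) atTop (𝓝 0) := by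
    have hzero : ∫ x in A, |v x - χ x| * (R * ‖fderiv ℝ ψ x‖) = 0 := by
      have : ∀ x, |v x - χ x| * (R * ‖fderiv ℝ ψ x‖) = 0 := by
        intro x
        by_cases hx : χ x - v x = 0
        · have : v x - χ x = 0 := by linarith
          simp [this]
        · have : fderiv ℝ ψ x = 0 := by
            have e : ψ =ᶠ[𝓝 x] fun _ => (1:ℝ) := hz x hx
            rw [e.fderiv_eq]; simp
          simp [this]
      simp [this]
    rw [← hzero]
    have cc := c.continuous_fderiv one_ne_zero
    refine tendsto_integral_of_dominated_convergence (fun x => (|v x| + 1) * (R * L)) ?_ ?_ ?_ ?_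
    · intro k
      have m1 : AEStronglyMeasurable (fun x => |v x - w k x|) (volume.restrict A) :=
        (iv.sub (hi k A hA)).abs.aestronglyMeasurable
      exact m1.mul (by fun_prop)
    · exact (iv.abs.add (integrableOn_const (finA hA).ne)).mul_const _
    · refine fun k => .of_forall fun x => ?_
      rw [Real.norm_of_nonneg (by positivity)]
      refine mul_le_mul ?_ (mul_le_mul_of_nonneg_left (hL x) hR0.le) (by positivity) (by positivity)
      exact (abs_sub _ _).trans (by linarith [hb k x])
    · refine .of_forall fun x => ?_
      exact ((hl x).const_sub (v x)).abs.mul_const _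
  have lim1 := lim_div (Ω := Ω) (fun k => hi k A hA) hb hl c1 (smul_cs hη.2.1)
  have key : ∫ x in A, χ x * divN (fun y => ψ y • η y) x ≤ s := by
    have := le_of_tendsto_of_tendsto lim1 (lim2.const_add s) (.of_forall fun k =>
      cut h (hmin k) hv hA c h0 h1 hL cs ts hR hs1 hη)
    simpa using this
  have key2 : ∫ x in A, χ x * divN (fun y => (1 - ψ y) • η y) x
      = ∫ x in A, v x * divN (fun y => (1 - ψ y) • η y) x := by
    congr 1; ext x
    by_cases hx : χ x - v x = 0
    · rw [sub_eq_zero.1 hx]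
    · have : divN (fun y => (1 - ψ y) • η y) x = 0 := by
        have e : (fun y => (1 - ψ y) • η y) =ᶠ[𝓝 x] fun _ => (0 : Rn n) := by
          filter_upwards [hz x hx] with y hy
          simp [hy]
        unfold divN
        rw [e.fderiv_eq]; simp
      simp [this]
  have e : (fun y => ψ y • η y + (1 - ψ y) • η y) = η := by
    ext1 y
    rw [← add_smul]; simp
  have e2 : ∀ x, divN η x = divN (fun y => ψ y • η y) x + divN (fun y => (1 - ψ y) • η y) x := by
    intro x
    rw [← divN_add c1 c2, e]
  simp only [e2, mul_add]
  rw [integral_add (int_divN iχ c1 (smul_cs hη.2.1)) (int_divN iχ c2 (smul_cs hη.2.1)), key2]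
  linarith [hs2 η hη]

theorem minG_iff {n : ℕ} {Φ : Rn1 n → ℝ} {φ : Rn n → ℝ} (h : IsNormN φ) (hc : Cylindrical Φ φ)
    {Ω : Set (Rn n)} {u : Rn n → ℝ} : MinG Φ Ω u ↔ MinV φ Ω u := by
  have key : ∀ A, CpCtd A Ω → ∃ T : ℝ, ∀ w, BVlocFun Ω w →
      ∀ M, Gfun Φ w A ≤ M + T ↔ Bd φ A w M := by
    intro A hA
    let P : (Rn n → ℝ) → Prop := fun g => ContDiff ℝ 1 g ∧ HasCompactSupport g ∧ tsupport g ⊆ A ∧ ∀ x, |g x| ≤ 1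
    have gi : ∀ g, P g → IntegrableOn g A := fun g hg =>
      int_bdd hA hg.1.continuous.aestronglyMeasurable hg.2.2.2
    have P0 : P (fun _ => 0) := by
      refine ⟨contDiff_const, HasCompactSupport.zero, ?_, fun x => by simp⟩
      have : tsupport (fun _ : Rn n => (0 : ℝ)) = ∅ := tsupport_eq_empty_iff.2 rfl
      rw [this]; exact empty_subset _
    let Sset : Set ℝ := {s | ∃ g, P g ∧ s = ∫ x in A, g x}
    have Sb : BddAbove Sset := by
      refine ⟨∫ x in A, (1:ℝ), ?_⟩
      rintro _ ⟨g, hg, rfl⟩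
      exact integral_mono (gi g hg) (integrableOn_const (finA hA).ne) fun x => (abs_le.1 (hg.2.2.2 x)).2
    have mk : ∀ w, IntegrableOn w A → ∀ r, r ∈ Gset Φ A w ↔
        ∃ η g, TestN A φ η ∧ P g ∧ r = (∫ x in A, w x * divN η x) + ∫ x in A, g x := by
      intro w hw r
      constructor
      · rintro ⟨η, c, s, t, b, rfl⟩
        have t1 : tsupport (fun y => (η y).1) ⊆ tsupport η := by
          refine closure_mono fun x hx hx' => hx ?_
          simp [hx']
        have t2 : tsupport (fun y => (η y).2) ⊆ tsupport η := by
          refine closure_mono fun x hx hx' => hx ?_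
          simp [hx']
        have hT : TestN A φ (fun y => (η y).1) := ⟨c.fst, s.of_isClosed_subset (isClosed_tsupport _) t1,
          t1.trans t, fun x => by have := b x; rw [hc] at this; exact (le_max_left _ _).trans this⟩
        have hP : P (fun y => (η y).2) := ⟨c.snd, s.of_isClosed_subset (isClosed_tsupport _) t2,
          t2.trans t, fun x => by have := b x; rw [hc] at this; exact (le_max_right _ _).trans this⟩
        exact ⟨_, _, hT, hP, integral_add (int_divN hw hT.1 hT.2.1) (gi _ hP)⟩
      · rintro ⟨η, g, hT, hP, rfl⟩
        have t1 : tsupport (fun y => (η y, g y)) ⊆ tsupport η ∪ tsupport g := by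
          refine closure_minimal ?_ ((isClosed_tsupport _).union (isClosed_tsupport _))
          intro x hx
          by_contra hh
          simp only [mem_union, not_or] at hh
          apply hx
          simp [image_eq_zero_of_notMem_tsupport hh.1, image_eq_zero_of_notMem_tsupport hh.2]
        refine ⟨fun y => (η y, g y), hT.1.prodMk hP.1,
          (hT.2.1.isCompact.union hP.2.1.isCompact).of_isClosed_subset (isClosed_tsupport _) t1,
          t1.trans (union_subset hT.2.2.1 hP.2.2.1), fun x => ?_,
          (integral_add (int_divN hw hT.1 hT.2.1) (gi _ hP)).symm⟩
        rw [hc]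
        exact max_le (hT.2.2.2 x) (hP.2.2.2 x)
    refine ⟨sSup Sset, fun w hw M => ?_⟩
    obtain ⟨iw, N, hN⟩ := (bv_iff h).1 hw A hA
    have mk := mk w iw
    have Gb : BddAbove (Gset Φ A w) := by
      refine ⟨N + sSup Sset, fun r hr => ?_⟩
      obtain ⟨η, g, hT, hP, rfl⟩ := (mk r).1 hr
      exact add_le_add (hN η hT) (le_csSup Sb ⟨g, hP, rfl⟩)
    constructor
    · intro hG η hη
      have : sSup Sset ≤ M + sSup Sset - ∫ x in A, w x * divN η x := by
        refine csSup_le ⟨_, _, P0, rfl⟩ ?_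
        rintro _ ⟨g, hg, rfl⟩
        have := (le_csSup Gb ((mk _).2 ⟨η, g, hη, hg, rfl⟩)).trans hG
        linarith
      linarith
    · intro hM
      refine csSup_le ⟨_, (mk _).2 ⟨_, _, testZero h A, P0, rfl⟩⟩ fun r hr => ?_
      obtain ⟨η, g, hT, hP, rfl⟩ := (mk r).1 hr
      exact add_le_add (hM η hT) (le_csSup Sb ⟨g, hP, rfl⟩)
  constructor
  · rintro ⟨hb, hm⟩
    refine ⟨hb, fun A hA v hv hs M hM => ?_⟩
    obtain ⟨T, hT⟩ := key A hA
    exact (hT u hb M).1 ((hm A hA v hv hs).trans ((hT v hv M).2 hM))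
  · rintro ⟨hb, hm⟩
    refine ⟨hb, fun A hA v hv hs => ?_⟩
    obtain ⟨T, hT⟩ := key A hA
    have := (hT u hb (Gfun Φ v A - T)).2 (hm A hA v hv hs _ ((hT v hv _).1 (by linarith)))
    linarith

theorem st_deriv : (∀ t, 0 ≤ deriv Real.smoothTransition t) ∧
    ∃ C > (0:ℝ), ∀ t, deriv Real.smoothTransition t ≤ C := by
  refine ⟨fun t => Real.smoothTransition.monotone.deriv_nonneg, ?_⟩
  have hc : ContDiff ℝ 1 Real.smoothTransition := Real.smoothTransition.contDiff (n := 1)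
  have cs : HasCompactSupport (deriv Real.smoothTransition) := by
    refine HasCompactSupport.intro (isCompact_Icc (a := (0:ℝ)) (b := 1)) fun t ht => ?_
    have : t < 0 ∨ 1 < t := by
      by_contra hh; push Not at hh; exact ht hh
    rcases this with h | h
    · have : Real.smoothTransition =ᶠ[𝓝 t] fun _ => 0 := by
        filter_upwards [gt_mem_nhds h] with s hs
        exact Real.smoothTransition.zero_of_nonpos hs.le
      rw [this.deriv_eq]; simp
    · have : Real.smoothTransition =ᶠ[𝓝 t] fun _ => 1 := by
        filter_upwards [lt_mem_nhds h] with s hs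
        exact Real.smoothTransition.one_of_one_le hs.le
      rw [this.deriv_eq]; simp
  obtain ⟨C, hC⟩ := cs.exists_bound_of_continuous (hc.continuous_deriv le_rfl)
  exact ⟨max C 1, by positivity, fun t => (le_abs_self _).trans ((hC t).trans (le_max_left _ _))⟩

theorem min_step {n : ℕ} {φ : Rn n → ℝ} (h : IsNormN φ) {Ω : Set (Rn n)} {u : Rn n → ℝ}
    (hu : MinV φ Ω u) (a b : ℝ) (ha : 0 < a) :
    MinV φ Ω (fun x => Real.smoothTransition (a * u x + b)) := by
  obtain ⟨d0, C, hC, d1⟩ := st_deriv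
  have hCa : 0 < C * a := by positivity
  have hu2 := min_smul h hu hCa
  have hc : ContDiff ℝ 2 Real.smoothTransition := Real.smoothTransition.contDiff (n := 2)
  have hd : ∀ t, deriv (fun t => Real.smoothTransition (C⁻¹ * t + b)) t
      = C⁻¹ * deriv Real.smoothTransition (C⁻¹ * t + b) := by
    intro t
    have h1 : HasDerivAt (fun t : ℝ => C⁻¹ * t + b) C⁻¹ t := by
      simpa using ((hasDerivAt_id t).const_mul C⁻¹).add_const b
    have h2 := ((hc.differentiable two_ne_zero (C⁻¹ * t + b)).hasDerivAt).comp t h1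
    have h3 : deriv (fun t => Real.smoothTransition (C⁻¹ * t + b)) t = _ := h2.deriv
    rw [h3, mul_comm]
  have := min_comp h hu2 (H := fun t => Real.smoothTransition (C⁻¹ * t + b)) (B := 1)
    (hc.comp (by fun_prop))
    (fun t => abs_le.2 ⟨by linarith [Real.smoothTransition.nonneg (C⁻¹ * t + b)], Real.smoothTransition.le_one _⟩)
    (fun t => by rw [hd]; exact mul_nonneg (by positivity) (d0 _))
    (fun t => by rw [hd, inv_mul_le_iff₀ hC, mul_one]; exact d1 _)
  have e : ∀ x, C⁻¹ * (C * a * u x) + b = a * u x + b := fun x => by field_simp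
  simpa only [e] using this

theorem indicator_superlevel_minG {n : ℕ} (Φ : Rn1 n → ℝ) (φ : Rn n → ℝ)
    (hΦ : IsNorm1 Φ) (hφ : IsNormN φ) (hcyl : Cylindrical Φ φ)
    (Ω : Set (Rn n)) (hΩ : IsOpen Ω) (u : Rn n → ℝ) (hmin : MinG Φ Ω u) (l : ℝ) :
    MinG Φ Ω (Set.indicator {x : Rn n | l < u x} (fun _ => (1:ℝ))) ∧
    MinG Φ Ω (Set.indicator {x : Rn n | l ≤ u x} (fun _ => (1:ℝ))) := by
  rw [minG_iff hφ hcyl] at hmin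
  rw [minG_iff hφ hcyl, minG_iff hφ hcyl]
  have bd : ∀ t, |Real.smoothTransition t| ≤ 1 := fun t =>
    abs_le.2 ⟨by linarith [Real.smoothTransition.nonneg t], Real.smoothTransition.le_one _⟩
  have big : ∀ d : ℝ, 0 < d → ∀ᶠ k : ℕ in atTop, 1 ≤ ((k:ℝ) + 1) * d := by
    intro d hd
    have : Tendsto (fun k : ℕ => ((k:ℝ) + 1) * d) atTop atTop :=
      (tendsto_atTop_add_const_right _ _ tendsto_natCast_atTop_atTop).atTop_mul_const hd
    exact this.eventually_ge_atTop 1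
  constructor
  · refine min_limit hφ hΩ (w := fun k x => Real.smoothTransition (((k:ℝ) + 1) * u x + -(((k:ℝ) + 1) * l)))
      (fun k => min_step hφ hmin _ _ (by positivity)) (fun k x => bd _) fun x => ?_
    refine tendsto_const_nhds.congr' ?_
    by_cases hx : l < u x
    · filter_upwards [big (u x - l) (by linarith)] with k hk
      rw [Real.smoothTransition.one_of_one_le (by linarith)]
      simp [hx]
    · refine .of_forall fun k => ?_
      dsimp only
      have : ((k:ℝ) + 1) * u x ≤ ((k:ℝ) + 1) * l := mul_le_mul_of_nonneg_left (not_lt.1 hx) (by positivity)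
      rw [Real.smoothTransition.zero_of_nonpos (by linarith)]
      simp [hx]
  · refine min_limit hφ hΩ (w := fun k x => Real.smoothTransition (((k:ℝ) + 1) * u x + (1 -(((k:ℝ) + 1) * l))))
      (fun k => min_step hφ hmin _ _ (by positivity)) (fun k x => bd _) fun x => ?_
    refine tendsto_const_nhds.congr' ?_
    by_cases hx : l ≤ u x
    · refine .of_forall fun k => ?_
      dsimp only
      have : ((k:ℝ) + 1) * l ≤ ((k:ℝ) + 1) * u x := mul_le_mul_of_nonneg_left hx (by positivity)
      rw [Real.smoothTransition.one_of_one_le (by linarith)]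
      simp [hx]
    · filter_upwards [big (l - u x) (by linarith)] with k hk
      rw [Real.smoothTransition.zero_of_nonpos (by linarith)]
      simp [hx]
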